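/- Let u : [0,1]ⁿ → ℝ be continuous on [0,1]ⁿ, twice continuously differentiable on the open cube (0,1)ⁿ, and satisfy Δu(x) ≥ 1 for all x ∈ (0,1)ⁿ. Then for every t ∈ ℝ, every nonempty connected component of the set {x ∈ [0,1]ⁿ : u(x) ≥ t} contains a point of the topological boundary of the cube [0,1]ⁿ. -/

import Mathlib

/-- The Laplacian `Δu(x) = ∑ i, ∂²u/∂x_i²(x)`. -/
noncomputable def laplacian {n : ℕ} (u : EuclideanSpace ℝ (Fin n) → ℝ)
    (x : EuclideanSpace ℝ (Fin n)) : ℝ :=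
  ∑ i : Fin n,
    fderiv ℝ (fun y => fderiv ℝ u y (EuclideanSpace.single i 1)) x (EuclideanSpace.single i 1)

/-- The closed unit cube `[0,1]ⁿ`. -/
def unitCube (n : ℕ) : Set (EuclideanSpace ℝ (Fin n)) := {x | ∀ i, x i ∈ Set.Icc (0 : ℝ) 1}

/-- The open unit cube `(0,1)ⁿ`. -/
def openUnitCube (n : ℕ) : Set (EuclideanSpace ℝ (Fin n)) := {x | ∀ i, x i ∈ Set.Ioo (0 : ℝ) 1}

/-- A local maximum of a real function has nonpositive second derivative. -/
theorem IsLocalMax.deriv_deriv_nonpos {f : ℝ → ℝ} {a : ℝ} (h : IsLocalMax f a)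
    (hc : ContinuousAt f a) : deriv (deriv f) a ≤ 0 := by
  by_contra! hpos
  have hmin : IsLocalMin f a := isLocalMin_of_deriv_deriv_pos hpos h.deriv_eq_zero hc
  have hconst : f =ᶠ[nhds a] fun _ => f a := by
    filter_upwards [h, hmin] with y h₁ h₂ using le_antisymm h₁ h₂
  have hzero : deriv (deriv f) a = 0 := by
    rw [hconst.deriv.deriv_eq]
    simp
  exact hpos.ne' hzero

/-- Pure second directional derivatives are nonpositive at a local maximum. -/
theorem IsLocalMax.fderiv_fderiv_apply_nonpos {E : Type*} [NormedAddCommGroup E]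
    [NormedSpace ℝ E] {u : E → ℝ} {p : E} (h : IsLocalMax u p) (hu : ContDiffAt ℝ 2 u p) (v : E) :
    fderiv ℝ (fun y => fderiv ℝ u y v) p v ≤ 0 := by
  have hline : ∀ s : ℝ, HasDerivAt (fun s : ℝ => p + s • v) v s := fun s => by
    simpa using ((hasDerivAt_id s).smul_const v).const_add p
  have hp : p + (0 : ℝ) • v = p := by simp
  have hcont : Filter.Tendsto (fun s : ℝ => p + s • v) (nhds 0) (nhds p) := by
    simpa [ContinuousAt] using (hline 0).continuousAt
  have hdiff : ∀ᶠ y in nhds p, DifferentiableAt ℝ u y := by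
    filter_upwards [hu.eventually (by simp)] with y hy using hy.differentiableAt (by simp)
  have hfirst : deriv (fun s : ℝ => u (p + s • v)) =ᶠ[nhds 0]
      fun s => fderiv ℝ u (p + s • v) v := by
    filter_upwards [hcont.eventually hdiff] with s hs
    exact (hs.hasFDerivAt.comp_hasDerivAt s (hline s)).deriv
  have hfd : DifferentiableAt ℝ (fun y => fderiv ℝ u y v) p :=
    ((hu.fderiv_right (m := 1) (by norm_num)).differentiableAt (by simp)).clm_apply
      (differentiableAt_const v)
  have hsecond : deriv (deriv fun s : ℝ => u (p + s • v)) 0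
      = fderiv ℝ (fun y => fderiv ℝ u y v) p v := by
    rw [hfirst.deriv_eq]
    rw [← hp] at hfd
    have := (hfd.hasFDerivAt.comp_hasDerivAt (0 : ℝ) (hline 0)).deriv
    rw [hp] at this
    exact this
  rw [← hsecond]
  apply IsLocalMax.deriv_deriv_nonpos
  · have := hcont.eventually h
    filter_upwards [this] with s hs
    simpa using hs
  · have : ContinuousAt u (p + (0 : ℝ) • v) := by
      rw [hp]
      exact hu.continuousAt
    exact this.comp (f := fun s : ℝ => p + s • v) (hline 0).continuousAt

/-- In a compact Hausdorff space, a connected component contained in an open set has a clopen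
neighbourhood contained in that set. -/
theorem exists_isClopen_of_connectedComponent_subset {X : Type*} [TopologicalSpace X] [T2Space X]
    [CompactSpace X] {x : X} {U : Set X} (hU : IsOpen U) (h : connectedComponent x ⊆ U) :
    ∃ V : Set X, IsClopen V ∧ x ∈ V ∧ V ⊆ U := by
  rw [connectedComponent_eq_iInter_isClopen] at h
  have : Nonempty { s : Set X // IsClopen s ∧ x ∈ s } := ⟨⟨Set.univ, isClopen_univ, Set.mem_univ x⟩⟩
  obtain ⟨V, hV⟩ := exists_subset_nhds_of_compactSpace
    (V := fun s : { s : Set X // IsClopen s ∧ x ∈ s } => (s : Set X)) (U := U)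
    (hV := fun s t => ⟨⟨s ∩ t, s.2.1.inter t.2.1, s.2.2, t.2.2⟩, Set.inter_subset_left,
      Set.inter_subset_right⟩)
    (fun s => s.2.1.isClosed) (fun y hy => hU.mem_nhds (h hy))
  exact ⟨V, V.2.1, V.2.2, hV⟩

theorem isOpen_openUnitCube (n : ℕ) : IsOpen (openUnitCube n) := by
  simp only [openUnitCube, Set.ofPred_forall]
  exact isOpen_iInter_of_finite fun i =>
    isOpen_Ioo.preimage (by fun_prop : Continuous fun x : EuclideanSpace ℝ (Fin n) => x i)

theorem openUnitCube_subset_unitCube (n : ℕ) : openUnitCube n ⊆ unitCube n :=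
  fun _ hx i => Set.Ioo_subset_Icc_self (hx i)

theorem isCompact_unitCube (n : ℕ) : IsCompact (unitCube n) := by
  have h : IsCompact (Set.univ.pi fun _ : Fin n => Set.Icc (0 : ℝ) 1) :=
    isCompact_univ_pi fun _ => isCompact_Icc
  convert (EuclideanSpace.equiv (Fin n) ℝ).toHomeomorph.isCompact_preimage.2 h using 1
  ext x
  simp only [unitCube, Set.mem_ofPred_eq, Set.mem_preimage, Set.mem_univ_pi]
  rfl

theorem interior_unitCube_subset (n : ℕ) : interior (unitCube n) ⊆ openUnitCube n := by
  intro x hx i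
  have hopen : IsOpenMap fun y : EuclideanSpace ℝ (Fin n) => y i :=
    (EuclideanSpace.proj i : EuclideanSpace ℝ (Fin n) →L[ℝ] ℝ).isOpenMap
      fun r => ⟨EuclideanSpace.single i r, by simp⟩
  have himage : (fun y : EuclideanSpace ℝ (Fin n) => y i) '' unitCube n ⊆ Set.Icc 0 1 :=
    Set.image_subset_iff.2 fun y hy => hy i
  rw [← interior_Icc]
  exact interior_mono himage
    (hopen.image_interior_subset _ ⟨x, hx, rfl⟩)

/-- If `Δu ≥ 1` on `(0,1)ⁿ`, then every nonempty connected component of a superlevel set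
`{x ∈ [0,1]ⁿ : u(x) ≥ t}` touches the topological boundary of the cube. -/
theorem superlevel_components_touch_boundary {n : ℕ}
    (u : EuclideanSpace ℝ (Fin n) → ℝ)
    (hcont : ContinuousOn u (unitCube n)) (hC2 : ContDiffOn ℝ 2 u (openUnitCube n))
    (hlap : ∀ x ∈ openUnitCube n, 1 ≤ laplacian u x) (t : ℝ) :
    ∀ x ∈ {y ∈ unitCube n | t ≤ u y},
      ∃ z ∈ connectedComponentIn {y ∈ unitCube n | t ≤ u y} x,
        z ∈ frontier (unitCube n) := by
  intro x hx
  by_contra! hno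
  set K := {y ∈ unitCube n | t ≤ u y} with hK
  have hKclosed : IsClosed K :=
    hcont.preimage_isClosed_of_isClosed (isCompact_unitCube n).isClosed isClosed_Ici
  have hKcompact : IsCompact K := (isCompact_unitCube n).of_isClosed_subset hKclosed fun y hy => hy.1
  have : CompactSpace K := isCompact_iff_compactSpace.1 hKcompact
  obtain ⟨V, hV, hxV, hVU⟩ := exists_isClopen_of_connectedComponent_subset (x := (⟨x, hx⟩ : K))
    ((isOpen_openUnitCube n).preimage continuous_subtype_val) (by
      intro y hy
      have hyC : (y : EuclideanSpace ℝ (Fin n)) ∈ connectedComponentIn K x := by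
        rw [connectedComponentIn_eq_image hx]
        exact ⟨y, hy, rfl⟩
      by_contra hyo
      exact hno y hyC ⟨subset_closure y.2.1, fun hi => hyo (interior_unitCube_subset n hi)⟩)
  obtain ⟨p, hpV, hpmax⟩ := hV.isClosed.isCompact.exists_isMaxOn ⟨_, hxV⟩
    ((hcont.mono fun y hy => hy.1 : ContinuousOn u K).domRestrict.continuousOn)
  have hpo : (p : EuclideanSpace ℝ (Fin n)) ∈ openUnitCube n := hVU hpV
  have hmax : IsLocalMax u p := by
    obtain ⟨W, hW, hWV⟩ := isOpen_induced_iff.1 hV.isOpen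
    have hpW : (p : EuclideanSpace ℝ (Fin n)) ∈ W := by
      rw [← hWV] at hpV
      exact hpV
    filter_upwards [hW.mem_nhds hpW, (isOpen_openUnitCube n).mem_nhds hpo] with y hyW hyo
    by_cases hy : t ≤ u y
    · have hyV : (⟨y, openUnitCube_subset_unitCube n hyo, hy⟩ : K) ∈ V := by
        rw [← hWV]
        exact hyW
      exact hpmax hyV
    · exact (not_le.1 hy).le.trans p.2.2
  have hnonpos : laplacian u p ≤ 0 := Finset.sum_nonpos fun i _ =>
    hmax.fderiv_fderiv_apply_nonpos (hC2.contDiffAt ((isOpen_openUnitCube n).mem_nhds hpo)) _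
  linarith [hlap p hpo]
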